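/- Let m be a positive integer and a an integer with a > m. Then ∑_{k=1}^{m} ψ₀(k)·ψ₀(a+1-k)/(a+1-k) = (1/2)·∑_{k=1}^{m} ( ψ₀²(a+1-k)/k - ψ₁(k+a-m)/k ) + (1/(2(a-m)²))·(ψ₀(a-m+1) - ψ₀(a+1) + ψ₀(m+1) - ψ₀(1)) + (1/(2(a-m)))·(ψ₁(a+1) - ψ₁(a-m+1)) + (1/4)·( 2ψ₀(m+1)·(ψ₁(a+1) - ψ₀²(a-m+1)) + 2·(ψ₀(a+1) - ψ₀(a-m+1))·(ψ₁(a+1) - ψ₁(a-m+1)) - 2ψ₀(1)·ψ₁(a-m+1) - ψ₂(a-m+1) + 2ψ₀(1)·ψ₀²(a+1) + ψ₂(a+1) ). -/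

import Mathlib

open Finset

/-- Digamma function at a positive integer argument: `ψ₀ l = -γ + ∑_{i=1}^{l-1} 1/i`. -/
noncomputable def ψ₀ (l : ℕ) : ℝ :=
  -Real.eulerMascheroniConstant + ∑ i ∈ Finset.range (l - 1), (1 : ℝ) / (i + 1)

/-- Trigamma function at a positive integer argument: `ψ₁ l = π²/6 - ∑_{i=1}^{l-1} 1/i²`. -/
noncomputable def ψ₁ (l : ℕ) : ℝ :=
  Real.pi ^ 2 / 6 - ∑ i ∈ Finset.range (l - 1), (1 : ℝ) / (i + 1) ^ 2

/-- Tetragamma function at a positive integer argument: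
`ψ₂ l = -2ζ(3) + 2∑_{i=1}^{l-1} 1/i³`, where `ζ(3) = ∑_{i=1}^∞ 1/i³`. -/
noncomputable def ψ₂ (l : ℕ) : ℝ :=
  -2 * (∑' i : ℕ, (1 : ℝ) / (i + 1) ^ 3) +
    2 * ∑ i ∈ Finset.range (l - 1), (1 : ℝ) / (i + 1) ^ 3

theorem psi0_succ (l : ℕ) : ψ₀ (l + 2) = ψ₀ (l + 1) + 1 / ((l : ℝ) + 1) := by
  simp only [ψ₀, show l + 2 - 1 = l + 1 from rfl, show l + 1 - 1 = l from rfl,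
    Finset.sum_range_succ]
  ring

theorem psi1_succ (l : ℕ) : ψ₁ (l + 2) = ψ₁ (l + 1) - 1 / ((l : ℝ) + 1) ^ 2 := by
  simp only [ψ₁, show l + 2 - 1 = l + 1 from rfl, show l + 1 - 1 = l from rfl,
    Finset.sum_range_succ]
  ring

theorem psi2_succ (l : ℕ) : ψ₂ (l + 2) = ψ₂ (l + 1) + 2 / ((l : ℝ) + 1) ^ 3 := by
  simp only [ψ₂, show l + 2 - 1 = l + 1 from rfl, show l + 1 - 1 = l from rfl,
    Finset.sum_range_succ]
  ring

theorem sum_k (m : ℕ) : ∑ i ∈ range m, 1 / ((i : ℝ) + 1) = ψ₀ (m + 1) - ψ₀ 1 := by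
  induction m with
  | zero => simp
  | succ m ih => rw [sum_range_succ, ih, psi0_succ]; ring

theorem sum_r1 (d m : ℕ) :
    ∑ i ∈ range m, 1 / ((d : ℝ) + m - i) = ψ₀ (d + m + 1) - ψ₀ (d + 1) := by
  induction m with
  | zero => simp
  | succ m ih =>
    rw [sum_range_succ', show d + (m + 1) + 1 = d + m + 2 from rfl, psi0_succ]
    have : ∀ i ∈ range m, 1 / ((d : ℝ) + (m + 1 : ℕ) - (i + 1 : ℕ)) = 1 / ((d : ℝ) + m - i) := by
      intro i _; push_cast; ring_nf
    rw [sum_congr rfl this, ih]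
    push_cast; ring_nf

theorem sum_r2 (d m : ℕ) :
    ∑ i ∈ range m, 1 / ((d : ℝ) + m - i) ^ 2 = ψ₁ (d + 1) - ψ₁ (d + m + 1) := by
  induction m with
  | zero => simp
  | succ m ih =>
    rw [sum_range_succ', show d + (m + 1) + 1 = d + m + 2 from rfl, psi1_succ]
    have : ∀ i ∈ range m, 1 / ((d : ℝ) + (m + 1 : ℕ) - (i + 1 : ℕ)) ^ 2
        = 1 / ((d : ℝ) + m - i) ^ 2 := by
      intro i _; push_cast; ring_nf
    rw [sum_congr rfl this, ih]
    push_cast; ring_nf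

theorem S_succ (d m : ℕ) (hd : 0 < d) :
    ∑ i ∈ range (m + 1), ψ₀ (i + 1) / ((d : ℝ) + (m + 1 : ℕ) - i) ^ 2 =
      ∑ i ∈ range m, ψ₀ (i + 1) / ((d : ℝ) + m - i) ^ 2 + ψ₀ 1 / ((d : ℝ) + m + 1) ^ 2
      + 1 / ((d : ℝ) + m + 1) ^ 2 * (ψ₀ (m + 1) - ψ₀ 1 + (ψ₀ (d + m + 1) - ψ₀ (d + 1)))
      + 1 / ((d : ℝ) + m + 1) * (ψ₁ (d + 1) - ψ₁ (d + m + 1)) := by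
  rw [← sum_k, ← sum_r1, ← sum_r2, sum_range_succ', ← sum_add_distrib, mul_sum, mul_sum]
  have : ∀ i ∈ range m, ψ₀ (i + 1 + 1) / ((d : ℝ) + (m + 1 : ℕ) - (i + 1 : ℕ)) ^ 2
      = ψ₀ (i + 1) / ((d : ℝ) + m - i) ^ 2
      + 1 / ((d : ℝ) + m + 1) ^ 2 * (1 / ((i : ℝ) + 1) + 1 / ((d : ℝ) + m - i))
      + 1 / ((d : ℝ) + m + 1) * (1 / ((d : ℝ) + m - i) ^ 2) := by
    intro i hi
    have hi : i < m := mem_range.1 hi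
    obtain ⟨e, rfl⟩ := Nat.exists_eq_add_of_lt hi
    rw [psi0_succ]
    have h1 : (i : ℝ) + 1 ≠ 0 := by positivity
    have hx : (d : ℝ) + e + 1 ≠ 0 := by positivity
    have hy : (d : ℝ) + e + 1 + (i + 1) ≠ 0 := by positivity
    push_cast
    rw [show (d : ℝ) + (i + e + 1 + 1) - (i + 1) = d + e + 1 by ring,
      show (d : ℝ) + (i + e + 1) - i = d + e + 1 by ring,
      show (d : ℝ) + (i + e + 1) + 1 = d + e + 1 + (i + 1) by ring]
    generalize (d : ℝ) + e + 1 = x at *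
    generalize (i : ℝ) + 1 = y at *
    field_simp
    ring
  rw [sum_congr rfl this, sum_add_distrib, sum_add_distrib]
  push_cast; ring_nf

theorem second (d m : ℕ) (hd : 0 < d) :
    -(1 / 2) * ∑ i ∈ range m, ψ₀ (i + 1) / ((d : ℝ) + m - i) ^ 2 =
      -(1 / 2) * ∑ i ∈ range m, ψ₁ (i + 1 + d) / ((i : ℝ) + 1) +
        (1 / (2 * (d : ℝ) ^ 2)) * (ψ₀ (d + 1) - ψ₀ (d + m + 1) + ψ₀ (m + 1) - ψ₀ 1) +
        (1 / (2 * (d : ℝ))) * (ψ₁ (d + m + 1) - ψ₁ (d + 1)) +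
        (1 / 4) * (2 * ψ₀ (m + 1) * ψ₁ (d + m + 1) +
          2 * (ψ₀ (d + m + 1) - ψ₀ (d + 1)) * (ψ₁ (d + m + 1) - ψ₁ (d + 1)) -
          2 * ψ₀ 1 * ψ₁ (d + 1) - ψ₂ (d + 1) + ψ₂ (d + m + 1)) := by
  induction m with
  | zero => simp
  | succ m ih =>
    rw [S_succ d m hd, mul_add, mul_add, mul_add, ih, sum_range_succ,
      show d + (m + 1) + 1 = d + m + 2 from rfl, show m + 1 + 1 = m + 2 from rfl,
      psi0_succ, psi0_succ, psi1_succ, psi2_succ, show m + 1 + d = d + m + 1 by ring]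
    have h0 : (d : ℝ) ≠ 0 := by positivity
    have h1 : (m : ℝ) + 1 ≠ 0 := by positivity
    have h2 : (d : ℝ) + m + 1 ≠ 0 := by positivity
    push_cast
    field_simp
    ring

theorem first (a m : ℕ) (h : m < a) :
    ∑ i ∈ range m, ψ₀ (i + 1) * ψ₀ (a - i) / ((a : ℝ) - i) =
      (1 / 2) * ∑ i ∈ range m, ψ₀ (a - i) ^ 2 / ((i : ℝ) + 1) +
      (1 / 2) * (ψ₀ 1 * ψ₀ (a + 1) ^ 2 - ψ₀ (m + 1) * ψ₀ (a - m + 1) ^ 2) +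
      -(1 / 2) * ∑ i ∈ range m, ψ₀ (i + 1) / ((a : ℝ) - i) ^ 2 := by
  induction m with
  | zero => simp
  | succ m ih =>
    rw [sum_range_succ, sum_range_succ, sum_range_succ, ih (by omega)]
    obtain ⟨e, rfl⟩ := Nat.exists_eq_add_of_lt h
    rw [show m + 1 + e + 1 - m = e + 2 by omega, show m + 1 + e + 1 - (m + 1) = e + 1 by omega,
      show e + 2 + 1 = (e + 1) + 2 from rfl, show m + 1 + 1 = m + 2 from rfl, psi0_succ (e + 1),
      psi0_succ m]
    push_cast
    rw [show (m : ℝ) + 1 + e + 1 - m = e + 1 + 1 by ring]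
    have h1 : (m : ℝ) + 1 ≠ 0 := by positivity
    have h2 : (e : ℝ) + 1 + 1 ≠ 0 := by positivity
    field_simp
    ring

theorem stmt10 (m a : ℕ) (hm : 0 < m) (ha : m < a) :
    ∑ k ∈ Finset.Icc 1 m, ψ₀ k * ψ₀ (a + 1 - k) / ((a + 1 - k : ℕ) : ℝ) =
      (1 / 2) * ∑ k ∈ Finset.Icc 1 m,
          (ψ₀ (a + 1 - k) ^ 2 / (k : ℝ) - ψ₁ (k + a - m) / (k : ℝ)) +
        (1 / (2 * ((a : ℝ) - m) ^ 2)) *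
          (ψ₀ (a - m + 1) - ψ₀ (a + 1) + ψ₀ (m + 1) - ψ₀ 1) +
        (1 / (2 * ((a : ℝ) - m))) * (ψ₁ (a + 1) - ψ₁ (a - m + 1)) +
        (1 / 4) * (2 * ψ₀ (m + 1) * (ψ₁ (a + 1) - ψ₀ (a - m + 1) ^ 2) +
          2 * (ψ₀ (a + 1) - ψ₀ (a - m + 1)) * (ψ₁ (a + 1) - ψ₁ (a - m + 1)) -
          2 * ψ₀ 1 * ψ₁ (a - m + 1) - ψ₂ (a - m + 1) +
          2 * ψ₀ 1 * ψ₀ (a + 1) ^ 2 + ψ₂ (a + 1)) := by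
  obtain ⟨d, rfl⟩ := Nat.exists_eq_add_of_lt ha
  have hI : ∀ f : ℕ → ℝ, ∑ k ∈ Finset.Icc 1 m, f k = ∑ i ∈ range m, f (i + 1) := by
    intro f
    rw [range_eq_Ico, sum_Ico_add' f 0 m 1]
    rfl
  rw [hI, hI]
  have hL : ∀ i ∈ range m, ψ₀ (i + 1) * ψ₀ (m + d + 1 + 1 - (i + 1)) /
      ((m + d + 1 + 1 - (i + 1) : ℕ) : ℝ) =
      ψ₀ (i + 1) * ψ₀ (m + d + 1 - i) / (((m + d + 1 : ℕ) : ℝ) - i) := by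
    intro i hi
    have hi : i < m := mem_range.1 hi
    rw [show m + d + 1 + 1 - (i + 1) = m + d + 1 - i by omega,
      Nat.cast_sub (show i ≤ m + d + 1 by omega)]
  have hR : ∀ i ∈ range m, (ψ₀ (m + d + 1 + 1 - (i + 1)) ^ 2 / ((i + 1 : ℕ) : ℝ)
      - ψ₁ (i + 1 + (m + d + 1) - m) / ((i + 1 : ℕ) : ℝ)) =
      ψ₀ (m + d + 1 - i) ^ 2 / ((i : ℝ) + 1) - ψ₁ (i + 1 + (d + 1)) / ((i : ℝ) + 1) := by
    intro i hi
    rw [show m + d + 1 + 1 - (i + 1) = m + d + 1 - i by omega,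
      show i + 1 + (m + d + 1) - m = i + 1 + (d + 1) by omega]
    push_cast
    rfl
  rw [sum_congr rfl hL, sum_congr rfl hR, first _ _ ha, sum_sub_distrib]
  have h2 := second (d + 1) m (by omega)
  have hS : ∀ i ∈ range m, ψ₀ (i + 1) / (((m + d + 1 : ℕ) : ℝ) - i) ^ 2 =
      ψ₀ (i + 1) / (((d + 1 : ℕ) : ℝ) + m - i) ^ 2 := by
    intro i _
    push_cast
    ring_nf
  rw [sum_congr rfl hS, h2, show m + d + 1 - m = d + 1 by omega,
    show d + 1 + m + 1 = m + d + 1 + 1 by omega,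
    show ((m + d + 1 : ℕ) : ℝ) - m = ((d + 1 : ℕ) : ℝ) by push_cast; ring]
  ring
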